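/- Let R be a Noetherian ring, I an ideal, M a finitely generated R-module, and h an integer. Suppose H^i_I(M) = 0 for all i different from h and h+1. Then H^h_I(M) is I-cofinite if and only if H^{h+1}_I(M) is I-cofinite. -/

import Mathlib

open CategoryTheory

noncomputable section

universe u

/-- The Krull dimension of a module: `dim R/ann(M)`. -/
def moduleDim (R : Type u) [CommRing R] (M : Type*) [AddCommGroup M] [Module R M] :
    WithBot (WithTop ℕ) :=
  ringKrullDim (R ⧸ Module.annihilator R M)

/-- The depth of `M` with respect to an ideal `J`: the supremum of the lengths of
`M`-regular sequences consisting of elements of `J`. -/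
def moduleDepth (R : Type u) [CommRing R] (J : Ideal R) (M : Type*) [AddCommGroup M]
    [Module R M] : ℕ∞ :=
  sSup {n : ℕ∞ | ∃ rs : List R, (rs.length : ℕ∞) = n ∧ (∀ r ∈ rs, r ∈ J) ∧
    RingTheory.Sequence.IsRegular M rs}

/-- Serre's condition `S_ℓ` : for every prime `p` in the support of `M`,
`depth M_p ≥ min (ℓ, dim M_p)`. -/
def SerreCondition (R : Type u) [CommRing R] (ℓ : ℕ) (M : Type u) [AddCommGroup M]
    [Module R M] : Prop :=
  ∀ p ∈ Module.support R M,
    min ((ℓ : ℕ∞) : WithBot ℕ∞)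
        (moduleDim (Localization.AtPrime p.asIdeal) (LocalizedModule p.asIdeal.primeCompl M)) ≤
      ((moduleDepth (Localization.AtPrime p.asIdeal)
          (IsLocalRing.maximalIdeal (Localization.AtPrime p.asIdeal))
          (LocalizedModule p.asIdeal.primeCompl M) : ℕ∞) : WithBot ℕ∞)

/-- A module `N` over `S` is `J`-cofinite if its support is contained in `V(J)` and all the
modules `Ext^i_S(S/J, N)` are finitely generated. -/
def IsCofinite (S : Type u) [CommRing S] (J : Ideal S) (N : ModuleCat.{u} S) : Prop :=
  Module.support S N ⊆ PrimeSpectrum.zeroLocus (J : Set S) ∧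
  ∀ i : ℕ, Module.Finite S
    (((Ext S (ModuleCat.{u} S) i).obj (Opposite.op (ModuleCat.of S (S ⧸ J)))).obj N)

/-- A ring is catenary if any two saturated chains of primes with the same endpoints have
the same length. -/
def IsCatenaryRing (R : Type u) [CommRing R] : Prop :=
  ∀ c₁ c₂ : LTSeries (PrimeSpectrum R),
    c₁.head = c₂.head → c₁.last = c₂.last →
    (∀ i : Fin c₁.length, c₁.toFun i.castSucc ⋖ c₁.toFun i.succ) →
    (∀ i : Fin c₂.length, c₂.toFun i.castSucc ⋖ c₂.toFun i.succ) →
    c₁.length = c₂.length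

/-- A module is indecomposable if it is nonzero and is not the internal direct sum of two
nonzero submodules. -/
def ModuleIndecomposable (R : Type u) [CommRing R] (M : Type*) [AddCommGroup M]
    [Module R M] : Prop :=
  Nontrivial M ∧ ∀ N₁ N₂ : Submodule R M, IsCompl N₁ N₂ → N₁ = ⊥ ∨ N₂ = ⊥

/-- A module is equidimensional if `dim R/P = dim M` for every minimal prime `P`
of its support (equivalently, of its annihilator). -/
def Equidimensional (R : Type u) [CommRing R] (M : Type*) [AddCommGroup M]
    [Module R M] : Prop :=
  ∀ P ∈ (Module.annihilator R M).minimalPrimes, ringKrullDim (R ⧸ P) = moduleDim R M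

/-- A local ring is Cohen-Macaulay if its depth equals its Krull dimension. -/
def IsCMLocalRing (S : Type u) [CommRing S] [IsLocalRing S] : Prop :=
  ((moduleDepth S (IsLocalRing.maximalIdeal S) S : ℕ∞) : WithBot ℕ∞) = ringKrullDim S

/-- A ring is Cohen-Macaulay if all its localizations at primes are Cohen-Macaulay local
rings. -/
def IsCMRing (S : Type u) [CommRing S] : Prop :=
  ∀ p : PrimeSpectrum S, IsCMLocalRing (Localization.AtPrime p.asIdeal)
lemma HomologicalComplex.homologyUnop_inv_naturality {C ι : Type*} [Category* C] [Abelian C]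
    {c : ComplexShape ι} {K L : HomologicalComplex Cᵒᵖ c} (φ : K ⟶ L) (i : ι) :
    (L.homologyUnop i).inv ≫ homologyMap ((unopFunctor C c).map φ.op) i =
      (homologyMap φ i).unop ≫ (K.homologyUnop i).inv := by
  have h := congrArg Quiver.Hom.unop
    (homologyOp_hom_naturality ((unopFunctor C c).map φ.op) i)
  exact ((Iso.inv_comp_eq (L.homologyUnop i)).mpr
    (((Iso.comp_inv_eq (K.homologyUnop i)).mpr h).symm.trans (Category.assoc _ _ _)))

namespace CategoryTheory.ProjectiveResolution
variable {R : Type u} [CommRing R]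

/-- The map on `Hom`-complexes induced by a morphism of chain complexes. -/
def linearYonedaObjMap {K L : ChainComplex (ModuleCat.{u} R) ℕ} (φ : K ⟶ L)
    (Y : ModuleCat.{u} R) : L.linearYonedaObj R Y ⟶ K.linearYonedaObj R Y :=
  (HomologicalComplex.unopFunctor _ _).map
    ((((linearYoneda R (ModuleCat.{u} R)).obj Y).rightOp.mapHomologicalComplex _).map φ).op

lemma ext_map_comp_isoExt_hom {X X' : ModuleCat.{u} R} (g : X' ⟶ X)
    (P : ProjectiveResolution X) (P' : ProjectiveResolution X') (φ : Hom P' P g) (n : ℕ)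
    (Y : ModuleCat.{u} R) :
    ((Ext R (ModuleCat.{u} R) n).map g.op).app Y ≫ (P'.isoExt n Y).hom =
      (P.isoExt n Y).hom ≫ HomologicalComplex.homologyMap (linearYonedaObjMap φ.hom Y) n := by
  have comm : φ.hom.f 0 ≫ P.π.f 0 = P'.π.f 0 ≫ g := by
    simpa using φ.hom_f_zero_comp_π_f_zero
  have h₁ := congrArg Quiver.Hom.unop (isoLeftDerivedObj_inv_naturality g P' P φ.hom comm
    ((linearYoneda R (ModuleCat.{u} R)).obj Y).rightOp n)
  have h₂ := HomologicalComplex.homologyUnop_inv_naturality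
    ((((linearYoneda R (ModuleCat.{u} R)).obj Y).rightOp.mapHomologicalComplex _).map φ.hom) n
  exact (Category.assoc _ _ _).symm.trans ((congrArg (· ≫ _) h₁).trans
    ((Category.assoc _ _ _).trans ((congrArg (_ ≫ ·) h₂.symm).trans (Category.assoc _ _ _).symm)))

lemma smul_extMk {X Y : ModuleCat.{u} R} (P : ProjectiveResolution X) {n : ℕ} (r : R)
    (f : P.complex.X n ⟶ Y) (m : ℕ) (hm : n + 1 = m) (hf : P.complex.d m n ≫ f = 0) :
    P.extMk (r • f) m hm (by rw [Linear.comp_smul, hf, smul_zero]) = r • P.extMk f m hm hf := by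
  rw [Abelian.Ext.smul_eq_comp_mk₀, extMk_comp_mk₀]
  congr 1

/-- The cocycles of the `Hom`-complex of a projective resolution, as morphisms. -/
def cyclesHom {X : ModuleCat.{u} R} (P : ProjectiveResolution X) (Y : ModuleCat.{u} R) (n : ℕ) :
    (P.complex.linearYonedaObj R Y).cycles n →ₗ[R] (P.complex.X n ⟶ Y) :=
  ((P.complex.linearYonedaObj R Y).iCycles n).hom

section

variable {X : ModuleCat.{u} R} (P : ProjectiveResolution X) (Y : ModuleCat.{u} R) (n : ℕ)

lemma d_comp_cyclesHom (z : (P.complex.linearYonedaObj R Y).cycles n) :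
    P.complex.d (n + 1) n ≫ P.cyclesHom Y n z = 0 :=
  congr($((P.complex.linearYonedaObj R Y).iCycles_d n (n + 1)).hom z)

lemma cyclesHom_injective : Function.Injective (P.cyclesHom Y n) :=
  (ModuleCat.mono_iff_injective _).mp
    (inferInstanceAs (Mono ((P.complex.linearYonedaObj R Y).iCycles n)))

lemma exists_cyclesHom_eq (f : P.complex.X n ⟶ Y) (hf : P.complex.d (n + 1) n ≫ f = 0) :
    ∃ z, P.cyclesHom Y n z = f := by
  let K := P.complex.linearYonedaObj R Y
  have h := (ShortComplex.ShortExact.moduleCat_exact_iff_function_exact _).mp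
    (ShortComplex.exact_of_f_is_kernel (ShortComplex.mk _ _ (K.iCycles_d n (n + 1)))
      (K.cyclesIsKernel n (n + 1) (by simp)))
  exact (h f).mp hf

/-- The class in `Ext` of a cocycle of the `Hom`-complex of a projective resolution. -/
def cyclesToExt : (P.complex.linearYonedaObj R Y).cycles n →ₗ[R] Abelian.Ext X Y n where
  toFun z := P.extMk (P.cyclesHom Y n z) (n + 1) rfl (P.d_comp_cyclesHom Y n z)
  map_add' x y := by
    rw [add_extMk]; congr 1; exact map_add _ x y
  map_smul' r x := by
    rw [RingHom.id_apply, ← smul_extMk]; congr 1; exact map_smul _ r x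

lemma cyclesToExt_surjective : Function.Surjective (P.cyclesToExt Y n) := by
  intro α
  obtain ⟨f, hf, rfl⟩ := P.extMk_surjective α (n + 1) rfl
  obtain ⟨z, rfl⟩ := P.exists_cyclesHom_eq Y n f hf
  exact ⟨z, rfl⟩

variable {Y} in
lemma extMk_zero_eq_zero_iff (f : P.complex.X 0 ⟶ Y) (hf : P.complex.d 1 0 ≫ f = 0) :
    P.extMk f 1 rfl hf = 0 ↔ f = 0 := by
  refine ⟨fun h ↦ ?_, fun h ↦ by subst h; simp⟩
  simp only [← P.extEquivCohomologyClass.apply_eq_iff_eq, extEquivCohomologyClass_extMk,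
    extEquivCohomologyClass_zero,
    CochainComplex.HomComplex.CohomologyClass.mk_eq_zero_iff] at h
  rw [CochainComplex.HomComplex.Cocycle.toSingleMk_mem_coboundaries_iff _ _ _ _ _ 1 (by simp)] at h
  obtain ⟨g, hg⟩ := h
  have hz : Limits.IsZero (P.cochainComplex.X 1) :=
    P.cochainComplex.isZero_of_isStrictlyLE 0 1 (by simp)
  rw [hz.eq_of_src g 0, Limits.comp_zero] at hg
  simpa using hg.symm

lemma cyclesToExt_eq_zero_iff (z : (P.complex.linearYonedaObj R Y).cycles n) :
    P.cyclesToExt Y n z = 0 ↔ ((P.complex.linearYonedaObj R Y).homologyπ n).hom z = 0 := by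
  let K := P.complex.linearYonedaObj R Y
  have h (i : ℕ) (hi : (ComplexShape.up ℕ).prev n = i) :=
    (ShortComplex.ShortExact.moduleCat_exact_iff_function_exact _).mp
      (ShortComplex.exact_of_g_is_cokernel (ShortComplex.mk _ _ (K.toCycles_comp_homologyπ i n))
        (K.homologyIsCokernel i n hi)) z
  have hd (i : ℕ) (y : P.complex.X i ⟶ Y) :
      P.cyclesHom Y n ((K.toCycles i n).hom y) = P.complex.d n i ≫ y :=
    congr($(K.toCycles_i i n).hom y)
  change P.extMk (P.cyclesHom Y n z) (n + 1) rfl (P.d_comp_cyclesHom Y n z) = 0 ↔ _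
  cases n with
  | zero =>
    rw [extMk_zero_eq_zero_iff]
    refine Iff.trans ?_ (h 0 (by simp)).symm
    refine ⟨fun h ↦ ⟨0, ?_⟩, ?_⟩
    · rw [map_zero]; exact P.cyclesHom_injective Y 0 (by rw [h, map_zero])
    · rintro ⟨y, rfl⟩
      refine (hd 0 y).trans ?_
      rw [P.complex.shape _ _ (by simp)]
      exact Limits.zero_comp
  | succ n =>
    rw [extMk_eq_zero_iff _ _ _ _ _ n rfl]
    refine Iff.trans ?_ (h n (by simp)).symm
    constructor
    · rintro ⟨y, hy⟩
      exact ⟨y, P.cyclesHom_injective Y _ ((hd n y).trans hy)⟩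
    · rintro ⟨y, rfl⟩
      exact ⟨y, (hd n y).symm⟩

/-- The `Hom`-complex of a projective resolution computes the derived category `Ext`. -/
def homologyEquivExt :
    (P.complex.linearYonedaObj R Y).homology n ≃ₗ[R] Abelian.Ext X Y n :=
  have hπ : Function.Surjective ((P.complex.linearYonedaObj R Y).homologyπ n).hom :=
    (ModuleCat.epi_iff_surjective _).mp inferInstance
  have hk : LinearMap.ker ((P.complex.linearYonedaObj R Y).homologyπ n).hom =
      LinearMap.ker (P.cyclesToExt Y n) := by
    ext z
    simp only [LinearMap.mem_ker, cyclesToExt_eq_zero_iff]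
  (LinearMap.quotKerEquivOfSurjective _ hπ).symm ≪≫ₗ Submodule.quotEquivOfEq _ _ hk ≪≫ₗ
    LinearMap.quotKerEquivOfSurjective _ (P.cyclesToExt_surjective Y n)

lemma homologyEquivExt_homologyπ (z : (P.complex.linearYonedaObj R Y).cycles n) :
    P.homologyEquivExt Y n (((P.complex.linearYonedaObj R Y).homologyπ n).hom z) =
      P.cyclesToExt Y n z := by
  have hπ : Function.Surjective ((P.complex.linearYonedaObj R Y).homologyπ n).hom :=
    (ModuleCat.epi_iff_surjective _).mp inferInstance
  have : (LinearMap.quotKerEquivOfSurjective _ hπ).symm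
      (((P.complex.linearYonedaObj R Y).homologyπ n).hom z) = Submodule.Quotient.mk z := by
    rw [LinearEquiv.symm_apply_eq]; rfl
  simp only [homologyEquivExt, LinearEquiv.trans_apply, this]
  rfl

end

lemma homologyEquivExt_naturality {X X' : ModuleCat.{u} R} (g : X' ⟶ X)
    (P : ProjectiveResolution X) (P' : ProjectiveResolution X') (φ : Hom P' P g) (n : ℕ)
    (Y : ModuleCat.{u} R) (x : (P.complex.linearYonedaObj R Y).homology n) :
    P'.homologyEquivExt Y n
      ((HomologicalComplex.homologyMap (linearYonedaObjMap φ.hom Y) n).hom x) =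
      (Abelian.Ext.mk₀ g).comp (P.homologyEquivExt Y n x) (zero_add n) := by
  obtain ⟨z, rfl⟩ := (ModuleCat.epi_iff_surjective
    ((P.complex.linearYonedaObj R Y).homologyπ n)).mp inferInstance x
  have h₁ := congr($(HomologicalComplex.homologyπ_naturality (linearYonedaObjMap φ.hom Y) n).hom z)
  have h₂ := congr($(HomologicalComplex.cyclesMap_i (linearYonedaObjMap φ.hom Y) n).hom z)
  refine (congrArg (P'.homologyEquivExt Y n) h₁).trans ?_
  refine (P'.homologyEquivExt_homologyπ Y n _).trans ?_
  refine Eq.trans ?_ (congrArg (fun t => (Abelian.Ext.mk₀ g).comp t (zero_add n))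
    (P.homologyEquivExt_homologyπ Y n z).symm)
  refine Eq.trans ?_
    (mk₀_comp_extMk (P.cyclesHom Y n z) (n + 1) rfl (P.d_comp_cyclesHom Y n z) φ).symm
  change P'.extMk (P'.cyclesHom Y n _) (n + 1) rfl (P'.d_comp_cyclesHom Y n _) = _
  congr 1

end CategoryTheory.ProjectiveResolution

/-- The two definitions of `Ext` for modules agree. -/
def ModuleCat.extEquiv {R : Type u} [CommRing R] (X Y : ModuleCat.{u} R) (n : ℕ) :
    (((Ext R (ModuleCat.{u} R) n).obj (Opposite.op X)).obj Y) ≃ₗ[R] Abelian.Ext X Y n :=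
  ((CategoryTheory.projectiveResolution X).isoExt n Y).toLinearEquiv ≪≫ₗ
    (CategoryTheory.projectiveResolution X).homologyEquivExt Y n

lemma ModuleCat.extEquiv_naturality {R : Type u} [CommRing R] {X X' : ModuleCat.{u} R}
    (g : X' ⟶ X) (Y : ModuleCat.{u} R) (n : ℕ)
    (x : ((Ext R (ModuleCat.{u} R) n).obj (Opposite.op X)).obj Y) :
    extEquiv X' Y n ((((Ext R (ModuleCat.{u} R) n).map g.op).app Y).hom x) =
      (Abelian.Ext.mk₀ g).comp (extEquiv X Y n x) (zero_add n) := by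
  let P := CategoryTheory.projectiveResolution X
  let P' := CategoryTheory.projectiveResolution X'
  let φ : ProjectiveResolution.Hom P' P g :=
    { hom := ProjectiveResolution.lift g P' P
      hom_f_zero_comp_π_f_zero := ProjectiveResolution.lift_commutes_zero g P' P }
  have h := congr($(ProjectiveResolution.ext_map_comp_isoExt_hom g P P' φ n Y).hom x)
  exact (congrArg (P'.homologyEquivExt Y n) h).trans
    (ProjectiveResolution.homologyEquivExt_naturality g P P' φ n Y _)

/-- A direct limit over `ℕ` agrees with any colimit of the corresponding diagram. -/
def Module.DirectLimit.equivOfIsColimit {R : Type u} [CommRing R] {G : ℕ → Type u}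
    [∀ t, AddCommGroup (G t)] [∀ t, Module R (G t)] {f : ∀ t s, t ≤ s → G t →ₗ[R] G s}
    [DirectedSystem G (f · · ·)] {D : (ℕᵒᵖ)ᵒᵖ ⥤ ModuleCat.{u} R} {c : Limits.Cocone D}
    (hc : Limits.IsColimit c) (e : ∀ t, D.obj (Opposite.op (Opposite.op t)) ≃ₗ[R] G t)
    (he : ∀ (t s : ℕ) (h : t ≤ s) x,
      e s ((D.map (homOfLE h).op.op).hom x) = f t s h (e t x)) :
    Module.DirectLimit G f ≃ₗ[R] c.pt :=
  haveI : Limits.PreservesColimit D (forget (ModuleCat.{u} R)) :=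
    haveI : Limits.PreservesFilteredColimitsOfSize.{0, 0} (forget (ModuleCat.{u} R)) :=
      Limits.preservesFilteredColimitsOfSize_shrink.{0, u, 0, u} (forget (ModuleCat.{u} R))
    inferInstance
  LinearEquiv.ofBijective
    (Module.DirectLimit.lift R ℕ _ _
      (fun t ↦ (c.ι.app (Opposite.op (Opposite.op t))).hom ∘ₗ (e t).symm.toLinearMap)
      (fun t s h x ↦ by
        obtain ⟨x, rfl⟩ := (e t).surjective x
        rw [← he]
        simp only [LinearMap.comp_apply, LinearEquiv.coe_coe, LinearEquiv.symm_apply_apply]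
        exact congr($(c.w (homOfLE h).op.op).hom x)))
    ⟨by
      rw [injective_iff_map_eq_zero]
      intro z hz
      obtain ⟨t, x, rfl⟩ := Module.DirectLimit.exists_of z
      obtain ⟨x, rfl⟩ := (e t).surjective x
      rw [Module.DirectLimit.lift_of] at hz
      simp only [LinearMap.comp_apply, LinearEquiv.coe_coe, LinearEquiv.symm_apply_apply] at hz
      obtain ⟨s, φ, ψ, hs⟩ := Limits.Concrete.isColimit_exists_of_rep_eq D hc x
        (0 : D.obj (Opposite.op (Opposite.op t))) (hz.trans (map_zero _).symm)
      have hle : t ≤ s.unop.unop := leOfHom φ.unop.unop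
      rw [← Module.DirectLimit.of_f (hij := hle), ← he]
      have h0 : (D.map (homOfLE hle).op.op).hom x = 0 := hs.trans (map_zero _)
      rw [h0, map_zero, map_zero],
    fun y ↦ by
      obtain ⟨t, x, rfl⟩ := Limits.Concrete.isColimit_exists_rep D hc y
      refine ⟨Module.DirectLimit.of R ℕ _ _ t.unop.unop (e t.unop.unop x), ?_⟩
      rw [Module.DirectLimit.lift_of]
      simp only [LinearMap.comp_apply, LinearEquiv.coe_coe, LinearEquiv.symm_apply_apply]⟩

section
variable {R : Type u} [CommRing R] (I : Ideal R)

/-- The module `R / I ^ t`. -/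
abbrev powQuot (t : ℕ) : ModuleCat.{u} R := ModuleCat.of R (R ⧸ I ^ t)

/-- The projection `R / I ^ s ⟶ R / I ^ t` for `t ≤ s`. -/
def powQuotMap {t s : ℕ} (h : t ≤ s) : powQuot I s ⟶ powQuot I t :=
  ModuleCat.ofHom (Submodule.mapQ _ _ LinearMap.id (Ideal.pow_le_pow_right h))

lemma powQuotMap_self (t : ℕ) : powQuotMap I (le_refl t) = 𝟙 _ := by
  ext; rfl

lemma powQuotMap_comp {t s r : ℕ} (h : t ≤ s) (h' : s ≤ r) :
    powQuotMap I h' ≫ powQuotMap I h = powQuotMap I (h.trans h') := by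
  ext; rfl

variable (M : ModuleCat.{u} R) (i : ℕ)

/-- The transition maps in the direct system `Ext^i(R / I ^ t, M)`. -/
def extTransition (t s : ℕ) (h : t ≤ s) :
    Abelian.Ext (powQuot I t) M i →ₗ[R] Abelian.Ext (powQuot I s) M i :=
  (Abelian.Ext.mk₀ (powQuotMap I h)).precompOfLinear R M (zero_add i)

variable {I M i} in
lemma extTransition_apply {t s : ℕ} (h : t ≤ s) (x : Abelian.Ext (powQuot I t) M i) :
    extTransition I M i t s h x = (Abelian.Ext.mk₀ (powQuotMap I h)).comp x (zero_add i) := rfl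

instance : DirectedSystem (fun t ↦ Abelian.Ext (powQuot I t) M i)
    (fun t s h ↦ extTransition I M i t s h) where
  map_self t x := by simp [extTransition_apply, powQuotMap_self]
  map_map t s r h h' x := by
    rw [extTransition_apply, extTransition_apply, extTransition_apply,
      Abelian.Ext.mk₀_comp_mk₀_assoc, powQuotMap_comp]

/-- Local cohomology as the direct limit of the modules `Ext^i(R / I ^ t, M)`. -/
abbrev extLimit : Type u :=
  Module.DirectLimit (fun t ↦ Abelian.Ext (powQuot I t) M i) (extTransition I M i)

/-- The canonical map from `Ext^i(R / I ^ t, M)` to the direct limit. -/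
abbrev toExtLimit (t : ℕ) : Abelian.Ext (powQuot I t) M i →ₗ[R] extLimit I M i :=
  Module.DirectLimit.of R ℕ _ (extTransition I M i) t

/-- The diagram defining the local cohomology of `M`. -/
def extDiagram : (ℕᵒᵖ)ᵒᵖ ⥤ ModuleCat.{u} R :=
  localCohomology.diagram (localCohomology.idealPowersDiagram I) i ⋙ (evaluation _ _).obj M

/-- The colimit cocone exhibiting the local cohomology of `M`. -/
def localCohomologyCocone : Limits.Cocone (extDiagram I M i) :=
  ((evaluation _ _).obj M).mapCocone (Limits.colimit.cocone
    (localCohomology.diagram (localCohomology.idealPowersDiagram I) i))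

/-- The local cohomology of `M` is the colimit of `extDiagram`. -/
def isColimitLocalCohomologyCocone : Limits.IsColimit (localCohomologyCocone I M i) :=
  Limits.isColimitOfPreserves _ (Limits.colimit.isColimit _)

/-- Local cohomology is the direct limit of the modules `Ext^i(R / I ^ t, M)`. -/
def localCohomologyEquiv : extLimit I M i ≃ₗ[R] (localCohomology I i).obj M :=
  Module.DirectLimit.equivOfIsColimit (isColimitLocalCohomologyCocone I M i)
    (fun t ↦ (powQuot I t).extEquiv M i)
    (fun _ _ h x ↦ ModuleCat.extEquiv_naturality (powQuotMap I h) M i x)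

end

section powTorsion
variable {R : Type u} [CommRing R] (I : Ideal R)

/-- The submodule of elements annihilated by some power of `I`. -/
def powTorsion (M : Type*) [AddCommGroup M] [Module R M] : Submodule R M where
  carrier := {m | ∃ n : ℕ, ∀ a ∈ I ^ n, a • m = 0}
  zero_mem' := ⟨0, fun _ _ ↦ smul_zero _⟩
  add_mem' := by
    rintro x y ⟨n, hn⟩ ⟨m, hm⟩
    refine ⟨n + m, fun a ha ↦ ?_⟩
    rw [smul_add, hn a (Ideal.pow_le_pow_right (Nat.le_add_right n m) ha),
      hm a (Ideal.pow_le_pow_right (Nat.le_add_left m n) ha), add_zero]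
  smul_mem' := by
    rintro r x ⟨n, hn⟩
    exact ⟨n, fun a ha ↦ by rw [smul_comm, hn a ha, smul_zero]⟩

variable {I} {M N : Type*} [AddCommGroup M] [Module R M] [AddCommGroup N] [Module R N]

lemma map_mem_powTorsion (f : M →ₗ[R] N) {m : M} (hm : m ∈ powTorsion I M) :
    f m ∈ powTorsion I N := by
  obtain ⟨n, hn⟩ := hm
  exact ⟨n, fun a ha ↦ by rw [← map_smul, hn a ha, map_zero]⟩

lemma mem_powTorsion_of_injective {f : M →ₗ[R] N} (hf : Function.Injective f) {m : M}
    (hm : f m ∈ powTorsion I N) : m ∈ powTorsion I M := by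
  obtain ⟨n, hn⟩ := hm
  exact ⟨n, fun a ha ↦ hf (by rw [map_smul, hn a ha, map_zero])⟩

lemma powTorsion_powTorsion : powTorsion I (powTorsion I M) = ⊤ :=
  eq_top_iff.mpr fun m _ ↦ mem_powTorsion_of_injective (powTorsion I M).injective_subtype m.2

lemma exists_forall_pow_smul_eq_zero [Module.Finite R N] (f : N →ₗ[R] M)
    (hf : ∀ x, f x ∈ powTorsion I M) : ∃ n : ℕ, ∀ a ∈ I ^ n, ∀ x, a • f x = 0 := by
  obtain ⟨S, hS⟩ := Module.Finite.fg_top (R := R) (M := N)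
  choose n hn using hf
  refine ⟨S.sup n, fun a ha x ↦ ?_⟩
  have hx : x ∈ Submodule.span R (S : Set N) := hS ▸ Submodule.mem_top
  induction hx using Submodule.span_induction with
  | mem x hx => exact hn x a (Ideal.pow_le_pow_right (Finset.le_sup hx) ha)
  | zero => simp
  | add x y _ _ hx hy => rw [map_add, smul_add, hx, hy, add_zero]
  | smul r x _ hx => rw [map_smul, smul_comm, hx, smul_zero]

variable [IsNoetherianRing R]

lemma powTorsion_quotient_powTorsion : powTorsion I (M ⧸ powTorsion I M) = ⊥ := by
  refine eq_bot_iff.mpr fun x ⟨n, hn⟩ ↦ ?_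
  obtain ⟨m, rfl⟩ := Submodule.mkQ_surjective _ x
  let f : ↥(I ^ n) →ₗ[R] M := (LinearMap.toSpanSingleton R M m) ∘ₗ (I ^ n).subtype
  obtain ⟨k, hk⟩ := exists_forall_pow_smul_eq_zero (I := I) f fun a ↦
    (Submodule.Quotient.mk_eq_zero _).mp (hn a.1 a.2)
  refine (Submodule.mem_bot R).mpr ((Submodule.Quotient.mk_eq_zero _).mpr ⟨k + n, fun a ha ↦ ?_⟩)
  rw [pow_add] at ha
  induction ha using Submodule.mul_induction_on' with
  | mem_mul_mem a ha b hb => rw [mul_smul]; exact hk a ha ⟨b, hb⟩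
  | add a _ b _ ha hb => rw [add_smul, ha, hb, add_zero]

lemma injective_powTorsion (E : Type u) [AddCommGroup E] [Module R E] [Module.Injective R E] :
    Module.Injective R (powTorsion I E) := by
  refine Module.Baer.injective fun J f ↦ ?_
  obtain ⟨n, hn⟩ := exists_forall_pow_smul_eq_zero (I := I) ((powTorsion I E).subtype ∘ₗ f)
    fun x ↦ (f x).2
  obtain ⟨k, hk⟩ := I.exists_pow_inf_eq_pow_smul J
  let q : J →ₗ[R] R ⧸ I ^ (n + k) := (I ^ (n + k)).mkQ ∘ₗ J.subtype
  have hker : LinearMap.ker q ≤ LinearMap.ker ((powTorsion I E).subtype ∘ₗ f) := by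
    intro x hx
    have hx' : (x : R) ∈ I ^ (n + k) := (Submodule.Quotient.mk_eq_zero _).mp hx
    have hle : (I ^ (n + k) • ⊤ ⊓ J : Submodule R R) ≤ I ^ n • J := by
      rw [hk (n + k) (Nat.le_add_left k n), Nat.add_sub_cancel]
      exact Submodule.smul_mono le_rfl inf_le_right
    have hmem : (x : R) ∈ (I ^ n • J : Submodule R R) :=
      hle ⟨by simpa using hx', x.2⟩
    have key : ∀ y (hy : y ∈ (I ^ n • J : Submodule R R)), ∀ hyJ : y ∈ J,
        ((f ⟨y, hyJ⟩ : powTorsion I E) : E) = 0 := by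
      intro y hy
      induction hy using Submodule.smul_induction_on' with
      | smul a ha b hb =>
        intro hyJ
        have : (⟨a • b, hyJ⟩ : J) = a • ⟨b, hb⟩ := rfl
        rw [this, map_smul]
        exact hn a ha ⟨b, hb⟩
      | add y hy z hz ihy ihz =>
        intro hyJ
        have hy' := Submodule.smul_le_right hy
        have hz' := Submodule.smul_le_right hz
        have : (⟨y + z, hyJ⟩ : J) = ⟨y, hy'⟩ + ⟨z, hz'⟩ := rfl
        rw [this, map_add, Submodule.coe_add, ihy, ihz, add_zero]
    exact key x hmem x.2
  obtain ⟨g, hg⟩ := Module.Injective.out ((LinearMap.ker q).liftQ q le_rfl)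
    (LinearMap.ker_eq_bot.mp (Submodule.ker_liftQ_eq_bot _ _ _ le_rfl))
    ((LinearMap.ker q).liftQ ((powTorsion I E).subtype ∘ₗ f) hker)
  refine ⟨(g ∘ₗ (I ^ (n + k)).mkQ).codRestrict _ fun r ↦ ⟨n + k, fun a ha ↦ ?_⟩, fun x hx ↦ ?_⟩
  · rw [← map_smul, LinearMap.comp_apply]
    have : (I ^ (n + k)).mkQ (a • r) = 0 :=
      (Submodule.Quotient.mk_eq_zero _).mpr (Ideal.mul_mem_right r _ ha)
    rw [this, map_zero]
  · exact Subtype.ext (hg (Submodule.Quotient.mk ⟨x, hx⟩))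

end powTorsion

lemma Module.DirectLimit.map_exact {R ι : Type*} [CommRing R] [Preorder ι] [DecidableEq ι]
    [Nonempty ι] [IsDirectedOrder ι] {G G' G'' : ι → Type*}
    [∀ t, AddCommGroup (G t)] [∀ t, Module R (G t)]
    [∀ t, AddCommGroup (G' t)] [∀ t, Module R (G' t)]
    [∀ t, AddCommGroup (G'' t)] [∀ t, Module R (G'' t)]
    {f : ∀ t s, t ≤ s → G t →ₗ[R] G s} {f' : ∀ t s, t ≤ s → G' t →ₗ[R] G' s}
    {f'' : ∀ t s, t ≤ s → G'' t →ₗ[R] G'' s} [DirectedSystem G'' (f'' · · ·)]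
    {g : ∀ t, G t →ₗ[R] G' t} {g' : ∀ t, G' t →ₗ[R] G'' t}
    (hg : ∀ t s h, g s ∘ₗ f t s h = f' t s h ∘ₗ g t)
    (hg' : ∀ t s h, g' s ∘ₗ f' t s h = f'' t s h ∘ₗ g' t)
    (hex : ∀ t, Function.Exact (g t) (g' t)) :
    Function.Exact (Module.DirectLimit.map g hg) (Module.DirectLimit.map g' hg') := by
  intro y
  constructor
  · intro hy
    obtain ⟨t, y, rfl⟩ := Module.DirectLimit.exists_of y
    rw [Module.DirectLimit.map_apply_of] at hy
    obtain ⟨s, h, hs⟩ := Module.DirectLimit.of.zero_exact hy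
    rw [← LinearMap.comp_apply, ← hg', LinearMap.comp_apply] at hs
    obtain ⟨x, hx⟩ := (hex s _).mp hs
    exact ⟨Module.DirectLimit.of R ι G f s x, by
      rw [Module.DirectLimit.map_apply_of, hx, Module.DirectLimit.of_f]⟩
  · rintro ⟨x, rfl⟩
    obtain ⟨t, x, rfl⟩ := Module.DirectLimit.exists_of x
    rw [Module.DirectLimit.map_apply_of, Module.DirectLimit.map_apply_of,
      (hex t).apply_apply_eq_zero, map_zero]

section ExtMaps
variable {R : Type u} [CommRing R]

/-- The map `Ext^n(X, M) → Ext^n(X, N)` induced by `M ⟶ N`. -/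
def extMap (X : ModuleCat.{u} R) {M N : ModuleCat.{u} R} (f : M ⟶ N) (n : ℕ) :
    Abelian.Ext X M n →ₗ[R] Abelian.Ext X N n :=
  (Abelian.Ext.mk₀ f).postcompOfLinear R X (add_zero n)

/-- The connecting map `Ext^n(X, S.X₃) → Ext^(n+1)(X, S.X₁)`. -/
def extDelta (X : ModuleCat.{u} R) {S : ShortComplex (ModuleCat.{u} R)} (hS : S.ShortExact)
    (n : ℕ) : Abelian.Ext X S.X₃ n →ₗ[R] Abelian.Ext X S.X₁ (n + 1) :=
  hS.extClass.postcompOfLinear R X rfl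

lemma extMap_apply {X M N : ModuleCat.{u} R} (f : M ⟶ N) {n : ℕ} (x : Abelian.Ext X M n) :
    extMap X f n x = x.comp (Abelian.Ext.mk₀ f) (add_zero n) := rfl

lemma extDelta_apply {X : ModuleCat.{u} R} {S : ShortComplex (ModuleCat.{u} R)}
    (hS : S.ShortExact) {n : ℕ} (x : Abelian.Ext X S.X₃ n) :
    extDelta X hS n x = x.comp hS.extClass rfl := rfl

variable (X : ModuleCat.{u} R) {S : ShortComplex (ModuleCat.{u} R)} (hS : S.ShortExact) (n : ℕ)

lemma extMap_exact (hS : S.ShortExact) : Function.Exact (extMap X S.f n) (extMap X S.g n) := by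
  refine fun y ↦ ⟨Abelian.Ext.covariant_sequence_exact₂ X hS y, ?_⟩
  rintro ⟨x, rfl⟩
  rw [extMap_apply, extMap_apply, Abelian.Ext.comp_assoc_of_third_deg_zero,
    Abelian.Ext.mk₀_comp_mk₀, S.zero, Abelian.Ext.mk₀_zero, Abelian.Ext.comp_zero]

lemma extDelta_exact : Function.Exact (extMap X S.g n) (extDelta X hS n) := by
  refine fun y ↦ ⟨Abelian.Ext.covariant_sequence_exact₃ X hS y rfl, ?_⟩
  rintro ⟨x, rfl⟩
  rw [extMap_apply, extDelta_apply, Abelian.Ext.comp_assoc_of_second_deg_zero,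
    hS.comp_extClass, Abelian.Ext.comp_zero]

lemma extDelta_exact' : Function.Exact (extDelta X hS n) (extMap X S.f (n + 1)) := by
  refine fun y ↦ ⟨fun h ↦ Abelian.Ext.covariant_sequence_exact₁ X hS y h rfl, ?_⟩
  rintro ⟨x, rfl⟩
  rw [extMap_apply, extDelta_apply, Abelian.Ext.comp_assoc_of_third_deg_zero,
    hS.extClass_comp, Abelian.Ext.comp_zero]

lemma extMap_zero_injective {M N : ModuleCat.{u} R} (f : M ⟶ N) [Mono f] :
    Function.Injective (extMap X f 0) :=
  Abelian.Ext.postcomp_mk₀_injective_of_mono X f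

end ExtMaps

section ExtLimitMaps
variable {R : Type u} [CommRing R] (I : Ideal R)

lemma extMap_comp_extTransition {M N : ModuleCat.{u} R} (f : M ⟶ N) (n t s : ℕ) (h : t ≤ s) :
    extMap (powQuot I s) f n ∘ₗ extTransition I M n t s h =
      extTransition I N n t s h ∘ₗ extMap (powQuot I t) f n := by
  ext x
  exact Abelian.Ext.comp_assoc _ _ _ (zero_add n) (add_zero n) (by simp)

lemma extDelta_comp_extTransition {S : ShortComplex (ModuleCat.{u} R)} (hS : S.ShortExact)
    (n t s : ℕ) (h : t ≤ s) :
    extDelta (powQuot I s) hS n ∘ₗ extTransition I S.X₃ n t s h =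
      extTransition I S.X₁ (n + 1) t s h ∘ₗ extDelta (powQuot I t) hS n := by
  ext x
  exact Abelian.Ext.comp_assoc _ _ _ (zero_add n) rfl (by simp)

/-- The map `extLimit I M n → extLimit I N n` induced by `M ⟶ N`. -/
def extLimitMap {M N : ModuleCat.{u} R} (f : M ⟶ N) (n : ℕ) :
    extLimit I M n →ₗ[R] extLimit I N n :=
  Module.DirectLimit.map (fun t ↦ extMap (powQuot I t) f n) (extMap_comp_extTransition I f n)

/-- The connecting map `extLimit I S.X₃ n → extLimit I S.X₁ (n + 1)`. -/
def extLimitDelta {S : ShortComplex (ModuleCat.{u} R)} (hS : S.ShortExact) (n : ℕ) :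
    extLimit I S.X₃ n →ₗ[R] extLimit I S.X₁ (n + 1) :=
  Module.DirectLimit.map (fun t ↦ extDelta (powQuot I t) hS n) (extDelta_comp_extTransition I hS n)

variable {S : ShortComplex (ModuleCat.{u} R)} (hS : S.ShortExact) (n : ℕ)

lemma extLimitMap_exact (hS : S.ShortExact) :
    Function.Exact (extLimitMap I S.f n) (extLimitMap I S.g n) :=
  Module.DirectLimit.map_exact _ _ fun _ ↦ extMap_exact _ n hS

lemma extLimitDelta_exact : Function.Exact (extLimitMap I S.g n) (extLimitDelta I hS n) :=
  Module.DirectLimit.map_exact _ _ fun _ ↦ extDelta_exact _ hS n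

lemma extLimitDelta_exact' : Function.Exact (extLimitDelta I hS n) (extLimitMap I S.f (n + 1)) :=
  Module.DirectLimit.map_exact _ _ fun _ ↦ extDelta_exact' _ hS n

/-- Dimension shifting along a short exact sequence with acyclic middle term. -/
def extLimitShift [Subsingleton (extLimit I S.X₂ n)] [Subsingleton (extLimit I S.X₂ (n + 1))] :
    extLimit I S.X₃ n ≃ₗ[R] extLimit I S.X₁ (n + 1) :=
  LinearEquiv.ofBijective (extLimitDelta I hS n)
    ⟨(injective_iff_map_eq_zero _).mpr fun x hx ↦ by
      obtain ⟨y, rfl⟩ := (extLimitDelta_exact I hS n x).mp hx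
      rw [Subsingleton.elim y 0, map_zero],
    fun y ↦ (extLimitDelta_exact' I hS n y).mp (Subsingleton.elim _ _)⟩

/-- A surjection whose kernel has no higher local cohomology induces isomorphisms on local
cohomology in positive degrees. -/
def extLimitQuotient (hS : S.ShortExact) [Subsingleton (extLimit I S.X₁ n)]
    [Subsingleton (extLimit I S.X₁ (n + 1))] :
    extLimit I S.X₂ n ≃ₗ[R] extLimit I S.X₃ n :=
  LinearEquiv.ofBijective (extLimitMap I S.g n)
    ⟨(injective_iff_map_eq_zero _).mpr fun x hx ↦ by
      obtain ⟨y, rfl⟩ := (extLimitMap_exact I n hS x).mp hx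
      rw [Subsingleton.elim y 0, map_zero],
    fun y ↦ (extLimitDelta_exact I hS n y).mp (Subsingleton.elim _ _)⟩

end ExtLimitMaps

section Torsion
variable {R : Type u} [CommRing R] (I : Ideal R)

/-- Evaluation at `1`, as a map `Ext^0(R / I ^ t, M) → Γ_I(M)`. -/
def extEvalOne (M : ModuleCat.{u} R) (t : ℕ) :
    Abelian.Ext (powQuot I t) M 0 →ₗ[R] powTorsion I M :=
  (LinearMap.applyₗ (Submodule.Quotient.mk 1 : R ⧸ I ^ t) ∘ₗ
    (ModuleCat.homLinearEquiv (S := R)).toLinearMap ∘ₗ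
      (Abelian.Ext.linearEquiv₀ (R := R)).toLinearMap).codRestrict _ fun x ↦ ⟨t, fun a ha ↦ by
    let f := (Abelian.Ext.linearEquiv₀ (R := R) x).hom
    have h : a • (Submodule.Quotient.mk 1 : R ⧸ I ^ t) = 0 := by
      rw [← Submodule.Quotient.mk_smul, Submodule.Quotient.mk_eq_zero, smul_eq_mul, mul_one]
      exact ha
    exact (map_smul f a _).symm.trans ((congrArg f h).trans (map_zero f))⟩

lemma extEvalOne_mk₀ {M : ModuleCat.{u} R} {t : ℕ} (f : powQuot I t ⟶ M) :
    (extEvalOne I M t (Abelian.Ext.mk₀ f) : M) = f.hom (Submodule.Quotient.mk 1) := by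
  have h : Abelian.Ext.linearEquiv₀ (R := R) (Abelian.Ext.mk₀ f) = f := by
    rw [← Abelian.Ext.linearEquiv₀_symm_apply (R := R), LinearEquiv.apply_symm_apply]
  exact congrArg (fun g : powQuot I t ⟶ M ↦ g.hom (Submodule.Quotient.mk 1)) h

lemma extEvalOne_injective (M : ModuleCat.{u} R) (t : ℕ) :
    Function.Injective (extEvalOne I M t) := by
  rw [injective_iff_map_eq_zero]
  intro x hx
  obtain ⟨f, rfl⟩ := (Abelian.Ext.linearEquiv₀ (R := R)).symm.surjective x
  rw [Abelian.Ext.linearEquiv₀_symm_apply] at hx ⊢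
  have h1 : f.hom (Submodule.Quotient.mk 1) = 0 := by
    rw [← extEvalOne_mk₀, hx, Submodule.coe_zero]
  have hf : f = 0 := by
    ext
    exact h1
  rw [hf, Abelian.Ext.mk₀_zero]

lemma exists_extEvalOne_eq {M : ModuleCat.{u} R} (m : powTorsion I M) :
    ∃ t x, extEvalOne I M t x = m := by
  obtain ⟨m, n, hn⟩ := m
  refine ⟨n, Abelian.Ext.mk₀ (ModuleCat.ofHom
    ((I ^ n).liftQ (LinearMap.toSpanSingleton R M m) hn)), Subtype.ext ?_⟩
  rw [extEvalOne_mk₀]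
  exact one_smul R m

lemma extEvalOne_extTransition (M : ModuleCat.{u} R) (t s : ℕ) (h : t ≤ s)
    (x : Abelian.Ext (powQuot I t) M 0) :
    extEvalOne I M s (extTransition I M 0 t s h x) = extEvalOne I M t x := by
  obtain ⟨f, rfl⟩ := (Abelian.Ext.linearEquiv₀ (R := R)).symm.surjective x
  rw [Abelian.Ext.linearEquiv₀_symm_apply, extTransition_apply, Abelian.Ext.mk₀_comp_mk₀]
  refine Subtype.ext ?_
  rw [extEvalOne_mk₀, extEvalOne_mk₀]
  rfl

/-- In degree zero, local cohomology is the `I`-power torsion submodule. -/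
def extLimitZeroEquiv (M : ModuleCat.{u} R) : extLimit I M 0 ≃ₗ[R] powTorsion I M :=
  LinearEquiv.ofBijective
    (Module.DirectLimit.lift R ℕ _ _ (extEvalOne I M) (extEvalOne_extTransition I M))
    ⟨Module.DirectLimit.lift_injective _ _ (extEvalOne_injective I M), fun m ↦ by
      obtain ⟨t, x, rfl⟩ := exists_extEvalOne_eq I m
      exact ⟨toExtLimit I M 0 t x, Module.DirectLimit.lift_of _ _ _⟩⟩

lemma extLimitMap_zero_surjective {M N : ModuleCat.{u} R} (f : M ⟶ N)
    (hf : ∀ n ∈ powTorsion I N, ∃ m ∈ powTorsion I M, f.hom m = n) :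
    Function.Surjective (extLimitMap I f 0) := by
  intro y
  obtain ⟨m, hm, hmy⟩ := hf _ (extLimitZeroEquiv I N y).2
  obtain ⟨t, x, hx⟩ := exists_extEvalOne_eq I ⟨m, hm⟩
  refine ⟨toExtLimit I M 0 t x, (extLimitZeroEquiv I N).injective (Subtype.ext ?_)⟩
  rw [← hmy]
  rw [extLimitMap, Module.DirectLimit.map_apply_of]
  refine (congrArg Subtype.val (Module.DirectLimit.lift_of (extEvalOne I N)
    (extEvalOne_extTransition I N) _)).trans ?_
  obtain ⟨g, rfl⟩ := (Abelian.Ext.linearEquiv₀ (R := R)).symm.surjective x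
  rw [Abelian.Ext.linearEquiv₀_symm_apply] at hx ⊢
  rw [extMap_apply, Abelian.Ext.mk₀_comp_mk₀, extEvalOne_mk₀, ModuleCat.hom_comp,
    LinearMap.comp_apply, ← extEvalOne_mk₀, hx]

lemma subsingleton_extLimit {M : ModuleCat.{u} R} {n : ℕ}
    (h : ∀ t, Subsingleton (Abelian.Ext (powQuot I t) M n)) : Subsingleton (extLimit I M n) :=
  subsingleton_of_forall_eq 0 fun x ↦ by
    obtain ⟨t, x, rfl⟩ := Module.DirectLimit.exists_of x
    rw [Subsingleton.elim x 0, map_zero]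

lemma subsingleton_ext_zero {M : ModuleCat.{u} R} (hM : powTorsion I M = ⊥) (t : ℕ) :
    Subsingleton (Abelian.Ext (powQuot I t) M 0) := by
  have : Subsingleton (powTorsion I M) := by rw [hM]; infer_instance
  exact (extEvalOne_injective I M t).subsingleton

lemma powTorsion_eq_bot {M : ModuleCat.{u} R} [Subsingleton (extLimit I M 0)] :
    powTorsion I M = ⊥ :=
  (Submodule.subsingleton_iff_eq_bot).mp (extLimitZeroEquiv I M).symm.toEquiv.subsingleton

lemma exists_shortExact_of_mono {M E : ModuleCat.{u} R} (f : M ⟶ E) [Mono f] :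
    ∃ (N : ModuleCat.{u} R) (g : E ⟶ N) (w : f ≫ g = 0), (ShortComplex.mk f g w).ShortExact :=
  ⟨_, Limits.cokernel.π f, Limits.cokernel.condition f,
    { exact := ShortComplex.exact_cokernel f }⟩

/-- The complex `Γ_I(M) → M → M / Γ_I(M)`. -/
abbrev powTorsionShortComplex (M : ModuleCat.{u} R) : ShortComplex (ModuleCat.{u} R) where
  X₁ := ModuleCat.of R (powTorsion I M)
  X₂ := M
  X₃ := ModuleCat.of R (M ⧸ powTorsion I M)
  f := ModuleCat.ofHom (powTorsion I M).subtype
  g := ModuleCat.ofHom (powTorsion I M).mkQ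
  zero := by ext; simp

lemma shortExact_powTorsion (M : ModuleCat.{u} R) : (powTorsionShortComplex I M).ShortExact :=
  ModuleCat.shortComplex_shortExact _
    (LinearMap.exact_subtype_mkQ _) (Submodule.injective_subtype _) (Submodule.mkQ_surjective _)

variable [IsNoetherianRing R]

lemma injective_of_powTorsion (E : ModuleCat.{u} R) [Injective E] :
    Injective (ModuleCat.of R (powTorsion I E)) := by
  have : Module.Injective R E := (Module.injective_iff_injective_object R E).mpr inferInstance
  have := injective_powTorsion (I := I) E
  exact (Module.injective_iff_injective_object R _).mp inferInstance

/-- An injective presentation of a torsion module by a torsion module. -/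
lemma exists_shortExact_of_torsion {T : ModuleCat.{u} R} (hT : powTorsion I T = ⊤) :
    ∃ (Q N : ModuleCat.{u} R) (f : T ⟶ Q) (g : Q ⟶ N) (w : f ≫ g = 0),
      (ShortComplex.mk f g w).ShortExact ∧ Injective Q ∧ powTorsion I Q = ⊤ := by
  let E := Injective.under T
  let Q := ModuleCat.of R (powTorsion I E)
  have hι : Function.Injective (Injective.ι T).hom :=
    (ModuleCat.mono_iff_injective _).mp inferInstance
  let f : T ⟶ Q := ModuleCat.ofHom ((Injective.ι T).hom.codRestrict _ fun x ↦
    map_mem_powTorsion _ (hT ▸ Submodule.mem_top))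
  have : Mono f := (ModuleCat.mono_iff_injective _).mpr fun x y h ↦ hι (congrArg Subtype.val h)
  obtain ⟨N, g, w, hS⟩ := exists_shortExact_of_mono f
  exact ⟨Q, N, f, g, w, hS, injective_of_powTorsion I E, powTorsion_powTorsion⟩

/-- Torsion modules have no local cohomology in positive degrees. -/
lemma subsingleton_extLimit_succ_of_torsion (n : ℕ) {T : ModuleCat.{u} R}
    (hT : powTorsion I T = ⊤) : Subsingleton (extLimit I T (n + 1)) := by
  induction n generalizing T with
  | zero =>
    obtain ⟨Q, N, f, g, w, hS, hQ, hQ'⟩ := exists_shortExact_of_torsion I hT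
    have : Subsingleton (extLimit I Q 1) :=
      subsingleton_extLimit I fun t ↦ Abelian.Ext.subsingleton_of_injective _ _ _
    have hg : Function.Surjective g.hom := (ModuleCat.epi_iff_surjective _).mp hS.epi_g
    refine subsingleton_of_forall_eq 0 fun x ↦ ?_
    obtain ⟨y, rfl⟩ := (extLimitDelta_exact' I hS 0 x).mp
      (Subsingleton.elim (α := extLimit I Q 1) _ _)
    refine (extLimitDelta_exact I hS 0 y).mpr (extLimitMap_zero_surjective I g (fun z _ ↦ ?_) y)
    obtain ⟨x, rfl⟩ := hg z
    exact ⟨x, hQ' ▸ Submodule.mem_top, rfl⟩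
  | succ n ih =>
    obtain ⟨Q, N, f, g, w, hS, hQ, hQ'⟩ := exists_shortExact_of_torsion I hT
    have : Subsingleton (extLimit I Q (n + 2)) :=
      subsingleton_extLimit I fun t ↦ Abelian.Ext.subsingleton_of_injective _ _ _
    have hg : Function.Surjective g.hom := (ModuleCat.epi_iff_surjective _).mp hS.epi_g
    have hN : Subsingleton (extLimit I N (n + 1)) := ih <| eq_top_iff.mpr fun y _ ↦ by
      obtain ⟨x, rfl⟩ := hg y
      exact map_mem_powTorsion _ (hQ' ▸ Submodule.mem_top)
    refine subsingleton_of_forall_eq 0 fun x ↦ ?_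
    obtain ⟨y, rfl⟩ := (extLimitDelta_exact' I hS (n + 1) x).mp
      (Subsingleton.elim (α := extLimit I Q (n + 2)) _ _)
    rw [@Subsingleton.elim _ hN y 0, map_zero]

/-- `M` is acyclic for the functors `Hom(R / I ^ t, -)`, including in degree zero. -/
def ExtAcyclic (M : ModuleCat.{u} R) : Prop :=
  ∀ n t, Subsingleton (Abelian.Ext (powQuot I t) M n)

lemma extAcyclic_injective_quotient (E : ModuleCat.{u} R) [Injective E] :
    ExtAcyclic I (ModuleCat.of R (E ⧸ powTorsion I E)) := by
  rintro (_ | n) t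
  · exact subsingleton_ext_zero I powTorsion_quotient_powTorsion t
  · have hS := shortExact_powTorsion I E
    have : Injective (powTorsionShortComplex I E).X₂ := inferInstanceAs (Injective E)
    have : Injective (powTorsionShortComplex I E).X₁ := injective_of_powTorsion I E
    refine subsingleton_of_forall_eq 0 fun x ↦ ?_
    obtain ⟨y, rfl⟩ := (extDelta_exact (powQuot I t) hS (n + 1) x).mp
      (Abelian.Ext.eq_zero_of_injective _)
    rw [Abelian.Ext.eq_zero_of_injective y, map_zero]

lemma exists_shortExact_extAcyclic {M : ModuleCat.{u} R} (hM : powTorsion I M = ⊥) :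
    ∃ (E N : ModuleCat.{u} R) (f : M ⟶ E) (g : E ⟶ N) (w : f ≫ g = 0),
      (ShortComplex.mk f g w).ShortExact ∧ ExtAcyclic I E := by
  let E := Injective.under M
  let f : M ⟶ ModuleCat.of R (E ⧸ powTorsion I E) :=
    Injective.ι M ≫ ModuleCat.ofHom (powTorsion I E).mkQ
  have hι : Function.Injective (Injective.ι M).hom :=
    (ModuleCat.mono_iff_injective _).mp inferInstance
  have : Mono f := (ModuleCat.mono_iff_injective _).mpr <|
    (injective_iff_map_eq_zero f.hom).mpr fun x hx ↦ by
      have := mem_powTorsion_of_injective hι ((Submodule.Quotient.mk_eq_zero _).mp hx)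
      rwa [hM] at this
  obtain ⟨N, g, w, hS⟩ := exists_shortExact_of_mono f
  exact ⟨_, N, f, g, w, hS, extAcyclic_injective_quotient I E⟩

end Torsion

section Cofinite

lemma Module.Finite.middle_of_exact {R M N P : Type*} [CommRing R] [IsNoetherianRing R]
    [AddCommGroup M] [AddCommGroup N] [AddCommGroup P] [Module R M] [Module R N] [Module R P]
    [Module.Finite R M] [Module.Finite R P] {f : M →ₗ[R] N} {g : N →ₗ[R] P}
    (h : Function.Exact f g) : Module.Finite R N := by
  have := isNoetherian_of_range_eq_ker f g h.linearMap_ker_eq.symm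
  infer_instance

variable {R : Type u} [CommRing R] (I : Ideal R)

/-- All the modules `Ext^n(R / I, M)` are finitely generated. -/
def FgExt (M : ModuleCat.{u} R) : Prop :=
  ∀ n, Module.Finite R (Abelian.Ext (ModuleCat.of R (R ⧸ I)) M n)

variable {I}

lemma FgExt.of_linearEquiv {M N : ModuleCat.{u} R} (hM : FgExt I M) (e : M ≃ₗ[R] N) :
    FgExt I N := fun n ↦ by
  have := hM n
  refine Module.Finite.of_surjective (extMap _ (ModuleCat.ofHom e.toLinearMap) n) fun y ↦
    ⟨extMap _ (ModuleCat.ofHom e.symm.toLinearMap) n y, ?_⟩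
  rw [extMap_apply, extMap_apply, Abelian.Ext.comp_assoc_of_third_deg_zero,
    Abelian.Ext.mk₀_comp_mk₀, ← ModuleCat.ofHom_comp, LinearEquiv.comp_symm, ModuleCat.ofHom_id,
    Abelian.Ext.comp_mk₀_id]

lemma LinearEquiv.fgExt_iff {M N : ModuleCat.{u} R} (e : M ≃ₗ[R] N) : FgExt I M ↔ FgExt I N :=
  ⟨fun h ↦ h.of_linearEquiv e, fun h ↦ h.of_linearEquiv e.symm⟩

lemma ExtAcyclic.fgExt {M : ModuleCat.{u} R} (hM : ExtAcyclic I M) : FgExt I M := fun n ↦ by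
  have := hM n 1
  rw [powQuot, pow_one] at this
  infer_instance

variable [IsNoetherianRing R]

lemma fgExt_of_finite (M : ModuleCat.{u} R) [Module.Finite R M] : FgExt I M :=
  fun _ ↦ inferInstance

variable {S : ShortComplex (ModuleCat.{u} R)}

lemma FgExt.of_shortExact_left (hS : S.ShortExact) (h₂ : FgExt I S.X₂)
    (h₃ : FgExt I S.X₃) : FgExt I S.X₁
  | 0 => by
    have := h₂ 0
    have := hS.mono_f
    exact Module.Finite.of_injective _ (extMap_zero_injective _ S.f)
  | n + 1 => by
    have := h₃ n
    have := h₂ (n + 1)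
    exact Module.Finite.middle_of_exact (extDelta_exact' _ hS n)

lemma FgExt.of_shortExact_middle (hS : S.ShortExact) (h₁ : FgExt I S.X₁)
    (h₃ : FgExt I S.X₃) : FgExt I S.X₂ :=
  fun n ↦ by
    have := h₁ n
    have := h₃ n
    exact Module.Finite.middle_of_exact (extMap_exact _ n hS)

lemma FgExt.of_shortExact_right (hS : S.ShortExact) (h₁ : FgExt I S.X₁)
    (h₂ : FgExt I S.X₂) : FgExt I S.X₃ :=
  fun n ↦ by
    have := h₂ n
    have := h₁ (n + 1)
    exact Module.Finite.middle_of_exact (extDelta_exact _ hS n)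

end Cofinite

section DimensionShifting
variable {R : Type u} [CommRing R] [IsNoetherianRing R] {I : Ideal R}

/-- Dimension shifting for the functors `Ext^n(R / I ^ t, -)` on `I`-torsion-free modules. -/
lemma exists_dimensionShift {M : ModuleCat.{u} R} (hM : powTorsion I M = ⊥) :
    ∃ N : ModuleCat.{u} R, (∀ n, Nonempty (extLimit I N n ≃ₗ[R] extLimit I M (n + 1))) ∧
      (∀ n t, Subsingleton (Abelian.Ext (powQuot I t) N n) →
        Subsingleton (Abelian.Ext (powQuot I t) M (n + 1))) ∧
      (FgExt I M ↔ FgExt I N) := by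
  obtain ⟨E, N, f, g, w, hS, hE⟩ := exists_shortExact_extAcyclic I hM
  have hE' (n : ℕ) : Subsingleton (extLimit I E n) := subsingleton_extLimit I (hE n)
  refine ⟨N, fun n ↦ ?_, fun n t h ↦ subsingleton_of_forall_eq 0 fun x ↦ ?_,
    fun h ↦ .of_shortExact_right hS h hE.fgExt, .of_shortExact_left hS hE.fgExt⟩
  · have h₁ : Subsingleton (extLimit I (ShortComplex.mk f g w).X₂ n) := hE' n
    have h₂ : Subsingleton (extLimit I (ShortComplex.mk f g w).X₂ (n + 1)) := hE' (n + 1)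
    exact ⟨extLimitShift I hS n⟩
  · obtain ⟨y, rfl⟩ := (extDelta_exact' _ hS n x).mp (@Subsingleton.elim _ (hE (n + 1) t) _ _)
    rw [@Subsingleton.elim _ h y 0, map_zero]

lemma extAcyclic_of_subsingleton_extLimit {M : ModuleCat.{u} R}
    (hM : ∀ n, Subsingleton (extLimit I M n)) : ExtAcyclic I M := fun n ↦ by
  induction n generalizing M with
  | zero =>
    have := hM 0
    exact subsingleton_ext_zero I (powTorsion_eq_bot I)
  | succ n ih =>
    have := hM 0
    obtain ⟨N, e, hN, -⟩ := exists_dimensionShift (powTorsion_eq_bot I (M := M))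
    refine fun t ↦ hN n t (ih (fun k ↦ ?_) t)
    have := hM (k + 1)
    exact (e k).some.toEquiv.subsingleton

lemma fgExt_powTorsion_iff {M : ModuleCat.{u} R} (hM : FgExt I M) :
    FgExt I (ModuleCat.of R (powTorsion I M)) ↔
      FgExt I (ModuleCat.of R (M ⧸ powTorsion I M)) :=
  ⟨fun h ↦ .of_shortExact_right (shortExact_powTorsion I M) h hM,
    .of_shortExact_left (shortExact_powTorsion I M) hM⟩

lemma fgExt_iff_powTorsion {M : ModuleCat.{u} R}
    (hM : FgExt I (ModuleCat.of R (M ⧸ powTorsion I M))) :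
    FgExt I M ↔ FgExt I (ModuleCat.of R (powTorsion I M)) :=
  ⟨fun h ↦ .of_shortExact_left (shortExact_powTorsion I M) h hM,
    fun h ↦ .of_shortExact_middle (shortExact_powTorsion I M) h hM⟩

/-- Factoring out torsion does not change local cohomology in positive degrees. -/
def extLimitSuccEquiv (M : ModuleCat.{u} R) (n : ℕ) :
    extLimit I M (n + 1) ≃ₗ[R] extLimit I (ModuleCat.of R (M ⧸ powTorsion I M)) (n + 1) :=
  have h (k : ℕ) : Subsingleton (extLimit I (powTorsionShortComplex I M).X₁ (k + 1)) :=
    subsingleton_extLimit_succ_of_torsion (T := (powTorsionShortComplex I M).X₁) I k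
      powTorsion_powTorsion
  have := h n
  have := h (n + 1)
  extLimitQuotient I (S := powTorsionShortComplex I M) (n + 1) (shortExact_powTorsion I M)

/-- If the local cohomology of `M` is concentrated in degrees `h` and `h + 1`, the finiteness
conditions on the two modules are equivalent. -/
theorem fgExt_extLimit_iff {M : ModuleCat.{u} R} (hM : FgExt I M) (h : ℕ)
    (hv : ∀ i, i ≠ h → i ≠ h + 1 → Subsingleton (extLimit I M i)) :
    FgExt I (ModuleCat.of R (extLimit I M h)) ↔
      FgExt I (ModuleCat.of R (extLimit I M (h + 1))) := by
  induction h generalizing M with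
  | zero =>
    let M' := ModuleCat.of R (M ⧸ powTorsion I M)
    obtain ⟨N, e, -, hN⟩ := exists_dimensionShift (I := I) (M := M') powTorsion_quotient_powTorsion
    have hN' : FgExt I (ModuleCat.of R (N ⧸ powTorsion I N)) := by
      refine (extAcyclic_of_subsingleton_extLimit ?_).fgExt
      rintro (_ | n)
      · exact subsingleton_extLimit I (subsingleton_ext_zero I powTorsion_quotient_powTorsion)
      · have := hv (n + 2) (by simp) (by simp)
        exact ((extLimitSuccEquiv N n).symm ≪≫ₗ (e (n + 1)).some ≪≫ₗ
          (extLimitSuccEquiv M (n + 1)).symm).toEquiv.subsingleton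
    calc FgExt I (ModuleCat.of R (extLimit I M 0))
      _ ↔ FgExt I (ModuleCat.of R (powTorsion I M)) := (extLimitZeroEquiv I M).fgExt_iff
      _ ↔ FgExt I M' := fgExt_powTorsion_iff hM
      _ ↔ FgExt I N := hN
      _ ↔ FgExt I (ModuleCat.of R (powTorsion I N)) := fgExt_iff_powTorsion hN'
      _ ↔ FgExt I (ModuleCat.of R (extLimit I M 1)) :=
        ((extLimitZeroEquiv I N).symm ≪≫ₗ (e 0).some ≪≫ₗ (extLimitSuccEquiv M 0).symm).fgExt_iff
  | succ h ih =>
    have := hv 0 (by simp) (by simp)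
    obtain ⟨N, e, -, hN⟩ := exists_dimensionShift (powTorsion_eq_bot I (M := M))
    refine Iff.trans ?_ ((ih (hN.mp hM) fun i h₁ h₂ ↦ ?_).trans
      (LinearEquiv.fgExt_iff (M := .of R (extLimit I N (h + 1)))
        (N := .of R (extLimit I M (h + 2))) (e (h + 1)).some))
    · exact (LinearEquiv.fgExt_iff (M := .of R (extLimit I N h))
        (N := .of R (extLimit I M (h + 1))) (e h).some).symm
    have := hv (i + 1) (by simpa) (by simpa)
    exact (e i).some.toEquiv.subsingleton

end DimensionShifting

section Main
variable {R : Type u} [CommRing R] (I : Ideal R)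

lemma powTorsion_extLimit (M : ModuleCat.{u} R) (i : ℕ) : powTorsion I (extLimit I M i) = ⊤ :=
  eq_top_iff.mpr fun x _ ↦ by
    obtain ⟨t, x, rfl⟩ := Module.DirectLimit.exists_of x
    refine map_mem_powTorsion (toExtLimit I M i t) ⟨t, fun a ha ↦ ?_⟩
    have h : a • 𝟙 (powQuot I t) = 0 := by
      ext
      exact (Submodule.Quotient.mk_eq_zero _).mpr (by simpa using ha)
    rw [← Abelian.Ext.mk₀_id_comp x, ← Abelian.Ext.smul_comp, ← Abelian.Ext.mk₀_smul, h,
      Abelian.Ext.mk₀_zero, Abelian.Ext.zero_comp]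

lemma support_subset_zeroLocus {M : Type*} [AddCommGroup M] [Module R M]
    (hM : powTorsion I M = ⊤) : Module.support R M ⊆ PrimeSpectrum.zeroLocus (I : Set R) := by
  intro p hp a ha
  by_contra hap
  refine Module.notMem_support_iff'.mpr (fun m ↦ ?_) hp
  obtain ⟨n, hn⟩ : m ∈ powTorsion I M := hM ▸ Submodule.mem_top
  exact ⟨a ^ n, fun h ↦ hap (p.isPrime.mem_of_pow_mem n h), hn _ (Ideal.pow_mem_pow ha n)⟩

lemma isCofinite_localCohomology_iff (M : ModuleCat.{u} R) (i : ℕ) :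
    IsCofinite R I ((localCohomology I i).obj M) ↔ FgExt I (ModuleCat.of R (extLimit I M i)) := by
  have hsupp : Module.support R ((localCohomology I i).obj M) ⊆
      PrimeSpectrum.zeroLocus (I : Set R) := by
    rw [← (localCohomologyEquiv I M i).support_eq]
    exact support_subset_zeroLocus I (powTorsion_extLimit I M i)
  rw [(localCohomologyEquiv I M i).fgExt_iff (M := ModuleCat.of R _)]
  exact (and_iff_right hsupp).trans <| forall_congr' fun n ↦
    Module.Finite.equiv_iff (ModuleCat.extEquiv _ _ n)

end Main

theorem stmt7 (R : Type u) [CommRing R] [IsNoetherianRing R] (I : Ideal R)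
    (M : Type u) [AddCommGroup M] [Module R M] [Module.Finite R M] (h : ℕ)
    (hvanish : ∀ i : ℕ, i ≠ h → i ≠ h + 1 →
      Subsingleton ((localCohomology I i).obj (ModuleCat.of R M))) :
    IsCofinite R I ((localCohomology I h).obj (ModuleCat.of R M)) ↔
      IsCofinite R I ((localCohomology I (h + 1)).obj (ModuleCat.of R M)) := by
  rw [isCofinite_localCohomology_iff, isCofinite_localCohomology_iff]
  refine fgExt_extLimit_iff (fgExt_of_finite _) h fun i h₁ h₂ ↦ ?_
  have := hvanish i h₁ h₂
  exact (localCohomologyEquiv I _ i).toEquiv.subsingleton
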